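/- arXiv:math/0507353 — 5 statements merged into one kernel-verified Lean document; each statement's English description precedes it below -/
import Mathlib

section
/- For every integer n ≥ 1 and all real numbers a, b ≥ 0, the Lebesgue volume of the Minkowski sum aΔ_n + b(−Δ_n) equals Σ_{j=0}^{n} C(n,j) · a^j · b^{n−j} / (j!·(n−j)!). (Lemma 6, a Steiner-type decomposition formula.) -/
open MeasureTheory Pointwise

/-- The standard `n`-simplex in `ℝⁿ`. -/
def stdSimplex' (n : ℕ) : Set (Fin n → ℝ) :=
  {x | (∀ i, 0 ≤ x i) ∧ ∑ i, x i ≤ 1}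

/-- the closed-form polynomial -/
noncomputable def PP (n : ℕ) (a b : ℝ) : ℝ :=
  ∑ p ∈ Finset.HasAntidiagonal.antidiagonal n, (n.choose p.1 : ℝ) * (a ^ p.1 / p.1.factorial * (b ^ p.2 / p.2.factorial))

def SS (n : ℕ) (a b : ℝ) : Set (Fin n → ℝ) :=
  {x | ∑ i, max (x i) 0 ≤ a ∧ ∑ i, max (-x i) 0 ≤ b}

lemma PP_eq (n : ℕ) (a b : ℝ) : PP n a b = ∑ j ∈ Finset.range (n + 1),
        (n.choose j : ℝ) * a ^ j * b ^ (n - j) /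
          ((j.factorial : ℝ) * ((n - j).factorial : ℝ)) := by
  unfold PP
  rw [Finset.Nat.sum_antidiagonal_eq_sum_range_succ_mk]
  refine Finset.sum_congr rfl fun j _ => ?_
  dsimp only
  rw [mul_div_mul_comm]
  ring

lemma PP_nonneg (n : ℕ) {a b : ℝ} (ha : 0 ≤ a) (hb : 0 ≤ b) : 0 ≤ PP n a b := by
  unfold PP
  positivity

lemma PP_cont (n : ℕ) : Continuous (fun p : ℝ × ℝ => PP n p.1 p.2) := by
  unfold PP
  fun_prop

lemma set_eq (n : ℕ) {a b : ℝ} (ha : 0 ≤ a) (hb : 0 ≤ b) :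
    a • stdSimplex' n + b • (-stdSimplex' n) = SS n a b := by
  have key : ∀ (c : ℝ) (_ : 0 ≤ c) (u : Fin n → ℝ), (∀ i, 0 ≤ u i) → ∑ i, u i ≤ c →
      ∃ y ∈ stdSimplex' n, c • y = u := by
    intro c hc u hu hs
    rcases hc.eq_or_lt with rfl | hc
    · refine ⟨0, ⟨by simp, by simp⟩, ?_⟩
      have h0 : ∑ i, u i = 0 := le_antisymm hs (Finset.sum_nonneg fun i _ => hu i)
      rw [Finset.sum_eq_zero_iff_of_nonneg (fun i _ => hu i)] at h0
      ext i
      simp [h0 i (Finset.mem_univ i)]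
    · refine ⟨c⁻¹ • u, ⟨fun i => ?_, ?_⟩, by rw [smul_smul, mul_inv_cancel₀ hc.ne', one_smul]⟩
      · have := hu i
        simp only [Pi.smul_apply, smul_eq_mul]
        positivity
      · simp only [Pi.smul_apply, smul_eq_mul]
        rw [← Finset.mul_sum, inv_mul_le_iff₀ hc]
        linarith
  ext x
  constructor
  · rintro ⟨_, ⟨u, ⟨hu, hus⟩, rfl⟩, _, ⟨v, ⟨hv, hvs⟩, rfl⟩, rfl⟩
    simp only [Pi.neg_apply, Left.nonneg_neg_iff] at hv hvs
    have hv' : ∀ i, b * v i ≤ 0 := fun i => mul_nonpos_of_nonneg_of_nonpos hb (hv i)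
    have hu' : ∀ i, 0 ≤ a * u i := fun i => mul_nonneg ha (hu i)
    constructor
    · calc _ ≤ ∑ i, a * u i := by
            refine Finset.sum_le_sum fun i _ => ?_
            simp only [Pi.add_apply, Pi.smul_apply, smul_eq_mul]
            exact max_le (by linarith [hv' i]) (hu' i)
        _ ≤ a := by
            rw [← Finset.mul_sum]
            nlinarith
    · calc _ ≤ ∑ i, b * -v i := by
            refine Finset.sum_le_sum fun i _ => ?_
            simp only [Pi.add_apply, Pi.smul_apply, smul_eq_mul]
            exact max_le (by linarith [hu' i]) (by linarith [hv' i])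
        _ ≤ b := by
            rw [← Finset.mul_sum]
            nlinarith
  · rintro ⟨h1, h2⟩
    obtain ⟨y, hy, hy'⟩ := key a ha (fun i => max (x i) 0) (fun i => le_max_right _ _) h1
    obtain ⟨z, hz, hz'⟩ := key b hb (fun i => max (-x i) 0) (fun i => le_max_right _ _) h2
    refine ⟨a • y, ⟨y, hy, rfl⟩, b • (-z), ⟨-z, by simpa using hz, rfl⟩, ?_⟩
    dsimp only
    rw [smul_neg, hy', hz']
    ext i
    simp only [Pi.add_apply, Pi.neg_apply]
    rcases le_total (x i) 0 with h | h
    · rw [max_eq_right h, max_eq_left (by linarith)]; ring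
    · rw [max_eq_left h, max_eq_right (by linarith)]; ring

lemma SS_meas (n : ℕ) (a b : ℝ) : MeasurableSet (SS n a b) := by
  have h1 : Measurable fun x : Fin n → ℝ => ∑ i, max (x i) 0 := by fun_prop
  have h2 : Measurable fun x : Fin n → ℝ => ∑ i, max (-x i) 0 := by fun_prop
  exact (measurableSet_le h1 measurable_const).inter (measurableSet_le h2 measurable_const)

lemma PP_int (n : ℕ) (a b : ℝ) :
    PP (n + 1) a b = (∫ t in (-b)..0, PP n a (b + t)) + ∫ t in (0:ℝ)..a, PP n (a - t) b := by
  unfold PP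
  rw [Finset.sum_antidiagonal_choose_succ_mul
    (fun i j => a ^ i / i.factorial * (b ^ j / j.factorial))]
  congr 1
  · rw [intervalIntegral.integral_finsetSum
      (fun i _ => Continuous.intervalIntegrable (by fun_prop) _ _)]
    refine Finset.sum_congr rfl fun p _ => ?_
    simp only [intervalIntegral.integral_const_mul, intervalIntegral.integral_div]
    rw [intervalIntegral.integral_comp_add_left (fun t => t ^ p.2)]
    simp [Nat.factorial_succ]
    field_simp
    simp
  · rw [intervalIntegral.integral_finsetSum
      (fun i _ => Continuous.intervalIntegrable (by fun_prop) _ _)]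
    refine Finset.sum_congr rfl fun p hp => ?_
    simp only [intervalIntegral.integral_const_mul, intervalIntegral.integral_div,
      intervalIntegral.integral_mul_const]
    rw [intervalIntegral.integral_comp_sub_left (fun t => t ^ p.1)]
    rw [← Nat.choose_symm_of_eq_add (Finset.HasAntidiagonal.mem_antidiagonal.1 hp).symm]
    simp [Nat.factorial_succ]
    field_simp
    simp

lemma SS_empty (n : ℕ) {a b : ℝ} (h : a < 0 ∨ b < 0) : SS n a b = ∅ := by
  ext x
  simp only [SS, Set.mem_ofPred_eq, Set.mem_empty_iff_false, iff_false]
  rintro ⟨h1, h2⟩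
  have h3 : 0 ≤ ∑ i, max (x i) 0 := Finset.sum_nonneg fun i _ => le_max_right _ _
  have h4 : 0 ≤ ∑ i, max (-x i) 0 := Finset.sum_nonneg fun i _ => le_max_right _ _
  rcases h with h | h <;> linarith

lemma SS_succ (n : ℕ) (a b : ℝ) :
    volume (SS (n + 1) a b) = ∫⁻ t : ℝ, volume (SS n (a - max t 0) (b - max (-t) 0)) := by
  have e := (volume_preserving_piFinSuccAbove (fun _ : Fin (n + 1) => ℝ) 0).symm
  rw [← e.measure_preimage (SS_meas _ _ _).nullMeasurableSet]
  rw [Measure.volume_eq_prod, Measure.prod_apply (e.measurable (SS_meas _ _ _))]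
  refine lintegral_congr fun t => ?_
  congr 1
  ext y
  simp only [SS, Set.mem_preimage, Set.mem_ofPred_eq, MeasurableEquiv.piFinSuccAbove_symm_apply,
    Fin.sum_univ_succ, Fin.insertNthEquiv_zero, Fin.consEquiv_apply, Fin.cons_zero, Fin.cons_succ]
  constructor <;> rintro ⟨h1, h2⟩ <;> constructor <;> linarith

lemma SS_vol (n : ℕ) : ∀ {a b : ℝ}, 0 ≤ a → 0 ≤ b →
    volume (SS n a b) = ENNReal.ofReal (PP n a b) := by
  induction n with
  | zero =>
    intro a b ha hb
    have : SS 0 a b = Set.univ := by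
      ext x; simp [SS, ha, hb]
    rw [this, volume_pi, Measure.pi_univ]
    simp [PP]
  | succ n ih =>
    intro a b ha hb
    have hc : Continuous (fun t : ℝ => PP n (a - max t 0) (b - max (-t) 0)) :=
      (PP_cont n).comp (f := fun t : ℝ => (a - max t 0, b - max (-t) 0)) (by fun_prop)
    have hi : ∀ t ∈ Set.Ioc (-b) a, 0 ≤ a - max t 0 ∧ 0 ≤ b - max (-t) 0 := by
      rintro t ⟨h1, h2⟩
      exact ⟨sub_nonneg.2 (max_le h2 ha), sub_nonneg.2 (max_le (by linarith) hb)⟩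
    have h1 : ∫⁻ t : ℝ, volume (SS n (a - max t 0) (b - max (-t) 0)) =
        ∫⁻ t in Set.Icc (-b) a, volume (SS n (a - max t 0) (b - max (-t) 0)) := by
      rw [setLIntegral_eq_of_support_subset]
      intro t ht
      by_contra hn
      apply ht
      dsimp only
      rw [SS_empty, measure_empty]
      rw [Set.mem_Icc, not_and_or, not_le, not_le] at hn
      rcases hn with h | h
      · right
        linarith [le_max_left (-t) 0]
      · left
        linarith [le_max_left t 0]
    rw [SS_succ, h1, setLIntegral_congr Ioc_ae_eq_Icc.symm,
      setLIntegral_congr_fun measurableSet_Ioc (fun t ht => ih (hi t ht).1 (hi t ht).2),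
      ← ofReal_integral_eq_lintegral_ofReal, ← intervalIntegral.integral_of_le (by linarith),
      ← intervalIntegral.integral_add_adjacent_intervals (b := 0)
        (hc.intervalIntegrable _ _) (hc.intervalIntegrable _ _), PP_int]
    · congr 2
      · refine intervalIntegral.integral_congr fun t ht => ?_
        rw [Set.uIcc_of_le (by linarith)] at ht
        simp [max_eq_right ht.2, max_eq_left (neg_nonneg.2 ht.2)]
      · refine intervalIntegral.integral_congr fun t ht => ?_
        rw [Set.uIcc_of_le (by linarith)] at ht
        simp [max_eq_left ht.1, max_eq_right (neg_nonpos.2 ht.1)]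
    · exact hc.integrableOn_Ioc
    · filter_upwards [ae_restrict_mem measurableSet_Ioc] with t ht
      exact PP_nonneg n (hi t ht).1 (hi t ht).2

/-- Lemma 6: Steiner-type decomposition formula for the volume of the
Minkowski sum `aΔₙ + b(−Δₙ)`. -/
theorem volume_smul_simplex_add_smul_neg_simplex
    (n : ℕ) (hn : 1 ≤ n) (a b : ℝ) (ha : 0 ≤ a) (hb : 0 ≤ b) :
    volume (a • stdSimplex' n + b • (-stdSimplex' n)) =
      ENNReal.ofReal (∑ j ∈ Finset.range (n + 1),
        (n.choose j : ℝ) * a ^ j * b ^ (n - j) /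
          ((j.factorial : ℝ) * ((n - j).factorial : ℝ))) := by
  rw [set_eq n ha hb, SS_vol n ha hb, PP_eq]
end

section
/- For every integer n ≥ 1 and all real numbers a, b ≥ 0, the Minkowski sum aΔ_n + b(−Δ_n) equals the set {x ∈ ℝ^n : Σ_{i=1}^n max(x_i, 0) ≤ a and Σ_{i=1}^n max(−x_i, 0) ≤ b}. -/
open Pointwise

theorem mem_smul_simplex_aux (n : ℕ) (a : ℝ) (ha : 0 ≤ a) (y : Fin n → ℝ) :
    y ∈ a • stdSimplex' n ↔ (∀ i, 0 ≤ y i) ∧ ∑ i, y i ≤ a := by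
  rw [Set.mem_smul_set]
  constructor
  · rintro ⟨x, ⟨hx0, hx1⟩, rfl⟩
    refine ⟨fun i => mul_nonneg ha (hx0 i), ?_⟩
    simp only [Pi.smul_apply, smul_eq_mul, ← Finset.mul_sum]
    exact mul_le_of_le_one_right ha hx1
  · rintro ⟨h0, h1⟩
    rcases ha.eq_or_lt with rfl | hpos
    · refine ⟨0, ⟨fun i => le_rfl, by simp⟩, ?_⟩
      ext i
      have h2 : y i ≤ ∑ j, y j := Finset.single_le_sum (fun j _ => h0 j) (Finset.mem_univ i)
      have h3 := h0 i
      simp only [smul_zero, Pi.zero_apply]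
      linarith
    · refine ⟨a⁻¹ • y, ⟨fun i => mul_nonneg (inv_nonneg.2 ha) (h0 i), ?_⟩,
        smul_inv_smul₀ hpos.ne' y⟩
      simp only [Pi.smul_apply, smul_eq_mul, ← Finset.mul_sum]
      rw [inv_mul_le_iff₀ hpos, mul_one]
      exact h1

/-- The Minkowski sum `aΔₙ + b(−Δₙ)` is the set of points whose positive parts
sum to at most `a` and whose negative parts sum to at most `b`. -/
theorem smul_simplex_add_smul_neg_simplex_eq
    (n : ℕ) (hn : 1 ≤ n) (a b : ℝ) (ha : 0 ≤ a) (hb : 0 ≤ b) :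
    a • stdSimplex' n + b • (-stdSimplex' n) =
      {x : Fin n → ℝ | ∑ i, max (x i) 0 ≤ a ∧ ∑ i, max (-x i) 0 ≤ b} := by
  ext x
  rw [Set.smul_set_neg, Set.mem_add, Set.mem_setOf_eq]
  constructor
  · rintro ⟨u, hu, v, hv, rfl⟩
    rw [Set.mem_neg] at hv
    obtain ⟨hu0, hu1⟩ := (mem_smul_simplex_aux n a ha u).1 hu
    obtain ⟨hv0, hv1⟩ := (mem_smul_simplex_aux n b hb (-v)).1 hv
    simp only [Pi.neg_apply] at hv0 hv1
    constructor
    · refine (Finset.sum_le_sum fun i _ => ?_).trans hu1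
      refine max_le ?_ (hu0 i)
      have := hv0 i
      simp only [Pi.add_apply]
      linarith
    · refine (Finset.sum_le_sum fun i _ => ?_).trans hv1
      refine max_le ?_ (hv0 i)
      have := hu0 i
      simp only [Pi.add_apply]
      linarith
  · rintro ⟨h1, h2⟩
    refine ⟨fun i => max (x i) 0,
      (mem_smul_simplex_aux n a ha _).2 ⟨fun i => le_max_right _ _, h1⟩,
      -(fun i => max (-x i) 0), ?_, ?_⟩
    · rw [Set.mem_neg, neg_neg]
      exact (mem_smul_simplex_aux n b hb _).2 ⟨fun i => le_max_right _ _, h2⟩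
    · ext i
      simp only [Pi.add_apply, Pi.neg_apply]
      rcases le_total 0 (x i) with h | h
      · rw [max_eq_left h, max_eq_right (by linarith)]; ring
      · rw [max_eq_right h, max_eq_left (by linarith)]; ring
end

section
/- Let n ≥ 2 be an integer, ∂ an integer, and let d_0, d_1, …, d_n and s_0, s_1, …, s_{n−2} be integers satisfying d_0 = 1, d_1 = ∂, and d_k = ∂^k − Σ_{ℓ=2}^{k} C(k,ℓ)·∂^{k−ℓ}·s_{n−ℓ} for all 2 ≤ k ≤ n. Then for every 0 ≤ k ≤ n−2 one has s_k = (−1)^{n−k−1} · Σ_{ℓ=0}^{n−k} (−1)^ℓ · C(n−k,ℓ) · ∂^{n−k−ℓ} · d_ℓ. (The purely algebraic content of Proposition 5: the multidegrees d_k of a rational map of degree ∂ determine its Segre numbers s_k by this inversion formula.) -/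
theorem segre_aux_inv (d : ℤ) (t D : ℕ → ℤ) (m : ℕ)
    (h : ∀ k, k ≤ m → D k = ∑ l ∈ Finset.range (k + 1), (k.choose l : ℤ) * d ^ (k - l) * t l) :
    ∑ l ∈ Finset.range (m + 1), (-1) ^ l * (m.choose l : ℤ) * d ^ (m - l) * D l
      = (-1) ^ m * t m := by
  obtain ⟨L, hL⟩ : ∃ L : Polynomial ℤ →ₗ[ℤ] ℤ, ∀ j, L (Polynomial.X ^ j) = t j := by
    refine ⟨(Polynomial.basisMonomials ℤ).constr ℤ t, fun j => ?_⟩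
    have := (Polynomial.basisMonomials ℤ).constr_basis ℤ t j
    simp only [Polynomial.coe_basisMonomials] at this
    rwa [← Polynomial.X_pow_eq_monomial] at this
  have hD : ∀ k, k ≤ m → D k = L ((Polynomial.X + Polynomial.C d) ^ k) := by
    intro k hk
    rw [h k hk, add_pow, map_sum]
    refine Finset.sum_congr rfl fun l _ => ?_
    have : (Polynomial.X ^ l * Polynomial.C d ^ (k - l) * (k.choose l : Polynomial ℤ))
        = ((k.choose l : ℤ) * d ^ (k - l)) • (Polynomial.X ^ l : Polynomial ℤ) := by
      rw [Polynomial.smul_eq_C_mul]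
      simp
      ring
    rw [this, map_smul, hL, smul_eq_mul]
  have h2 : ((-1 : ℤ) ^ m) • (Polynomial.X ^ m : Polynomial ℤ)
      = (-(Polynomial.X + Polynomial.C d) + Polynomial.C d) ^ m := by
    rw [Polynomial.smul_eq_C_mul]
    simp only [map_pow, map_neg, map_one, ← mul_pow]
    congr 1
    ring
  rw [← hL m, ← smul_eq_mul, ← map_smul, h2, add_pow, map_sum]
  refine Finset.sum_congr rfl fun l hl => ?_
  rw [hD l (by simp at hl; omega), ← smul_eq_mul, ← map_smul]
  congr 1
  rw [Polynomial.smul_eq_C_mul, neg_pow (Polynomial.X + Polynomial.C d)]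
  simp only [map_mul, map_pow, map_neg, map_one, map_natCast]
  ring

/-- Proposition 5: if the multidegrees `d_k` of a rational map of degree `∂` satisfy
the relations of Proposition 5(i) with respect to the Segre numbers `s_k`, then the
Segre numbers are determined by the inversion formula of Proposition 5(ii). -/
theorem segre_numbers_from_multidegrees
    (n : ℕ) (hn : 2 ≤ n) (d : ℤ) (D S : ℕ → ℤ)
    (hD0 : D 0 = 1) (hD1 : D 1 = d)
    (hDk : ∀ k, 2 ≤ k → k ≤ n →
      D k = d ^ k - ∑ ℓ ∈ Finset.Icc 2 k, (k.choose ℓ : ℤ) * d ^ (k - ℓ) * S (n - ℓ)) :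
    ∀ k, k ≤ n - 2 →
      S k = (-1) ^ (n - k - 1) *
        ∑ ℓ ∈ Finset.range (n - k + 1),
          (-1) ^ ℓ * ((n - k).choose ℓ : ℤ) * d ^ (n - k - ℓ) * D ℓ := by

  intro k hk
  have key := segre_aux_inv d
    (fun j => if j = 0 then 1 else if j = 1 then 0 else - S (n - j)) D (n - k) ?_
  · rw [key]
    have h0 : n - k ≠ 0 := by omega
    have h1 : n - k ≠ 1 := by omega
    have h3 : n - (n - k) = k := by omega
    simp only [h0, h1, if_false, h3]
    obtain ⟨r, hr⟩ : ∃ r, n - k = r + 1 := ⟨n - k - 1, by omega⟩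
    rw [hr, Nat.add_sub_cancel, ← mul_assoc, pow_succ, ← mul_assoc, ← mul_pow]
    simp
  · intro j hj
    match j, hj with
    | 0, _ => simp [hD0]
    | 1, _ => simp [hD1, Finset.sum_range_succ]
    | j + 2, hj =>
      rw [hDk (j + 2) (by omega) (by omega), Finset.sum_range_succ', Finset.sum_range_succ',
        ← Finset.Ico_add_one_right_eq_Icc, Finset.sum_Ico_eq_sum_range]
      simp [add_comm, add_left_comm, sub_eq_add_neg]
end

section
/- Let n ≥ 2 be an integer and for 0 ≤ k ≤ n−2 define the integer s_k = (−1)^{n−k−1} · Σ_{j=0}^{n−k} (−1)^j · C(n−k,j) · C(n,j) · n^{n−k−j}. Then for every 2 ≤ k ≤ n one has C(n,k) = n^k − Σ_{ℓ=2}^{k} C(k,ℓ) · n^{k−ℓ} · s_{n−ℓ}. (The compatibility of Theorems 2 and 3: the Segre numbers of the standard Cremona transformation S_n, whose degree is n, are related to its multidegrees d_k = C(n,k) by the relation of Proposition 5(i).) -/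
theorem binom_inv_aux (d : ℕ → ℤ) (x : ℤ) (k : ℕ) :
    ∑ l ∈ Finset.range (k + 1), (k.choose l : ℤ) * x ^ (k - l) *
      (∑ j ∈ Finset.range (l + 1), (l.choose j : ℤ) * (-x) ^ (l - j) * d j) = d k := by
  let L : Polynomial ℤ →ₗ[ℤ] ℤ := (Polynomial.basisMonomials ℤ).constr ℤ d
  have hL : ∀ j, L (Polynomial.X ^ j) = d j := by
    intro j
    have := (Polynomial.basisMonomials ℤ).constr_basis ℤ d j
    simp only [Polynomial.coe_basisMonomials, Polynomial.monomial_one_right_eq_X_pow] at this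
    exact this
  have key : ∀ (p : Polynomial ℤ) (y : ℤ) (m : ℕ), L ((p + Polynomial.C y) ^ m) =
      ∑ j ∈ Finset.range (m + 1), (m.choose j : ℤ) * y ^ (m - j) * L (p ^ j) := by
    intro p y m
    rw [add_pow, map_sum]
    refine Finset.sum_congr rfl fun j _ => ?_
    rw [← smul_eq_mul (_ * _) (L (p ^ j)), ← map_smul]
    congr 1
    rw [Polynomial.smul_eq_C_mul]
    simp only [map_mul, map_pow, map_natCast]
    ring
  have h1 := key (Polynomial.X + Polynomial.C (-x)) x k
  have h2 : (Polynomial.X + Polynomial.C (-x) + Polynomial.C x : Polynomial ℤ) = Polynomial.X := by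
    simp
  rw [h2, hL] at h1
  rw [h1]
  refine Finset.sum_congr rfl fun l _ => ?_
  rw [key]
  simp only [hL]

/-- Compatibility of Theorems 2 and 3: the Segre numbers of the standard Cremona
transformation `Sₙ` (of degree `n`) and its multidegrees `d_k = C(n,k)` satisfy the
relation of Proposition 5(i). -/
theorem standard_cremona_segre_multidegree_relation
    (n : ℕ) (hn : 2 ≤ n)
    (s : ℕ → ℤ)
    (hs : ∀ k, k ≤ n - 2 →
      s k = (-1) ^ (n - k - 1) *
        ∑ j ∈ Finset.range (n - k + 1),
          (-1) ^ j * ((n - k).choose j : ℤ) * (n.choose j : ℤ) * (n : ℤ) ^ (n - k - j)) :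
    ∀ k, 2 ≤ k → k ≤ n →
      (n.choose k : ℤ) =
        (n : ℤ) ^ k - ∑ ℓ ∈ Finset.Icc 2 k, (k.choose ℓ : ℤ) * (n : ℤ) ^ (k - ℓ) * s (n - ℓ) := by
  intro k hk hkn
  have h := binom_inv_aux (fun j => (n.choose j : ℤ)) n k
  have hT : ∀ l ∈ Finset.Icc 2 k, s (n - l) =
      -(∑ j ∈ Finset.range (l + 1), (l.choose j : ℤ) * (-(n : ℤ)) ^ (l - j) * (n.choose j : ℤ)) := by
    intro l hl
    rw [Finset.mem_Icc] at hl
    rw [hs (n - l) (by omega), show n - (n - l) = l by omega, Finset.mul_sum,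
      ← Finset.sum_neg_distrib]
    refine Finset.sum_congr rfl fun j hj => ?_
    rw [Finset.mem_range] at hj
    obtain ⟨i, rfl⟩ : ∃ i, l = j + i := ⟨l - j, by omega⟩
    have e : (-1 : ℤ) ^ (j + i - 1) * (-1) ^ j = -(-1) ^ i := by
      have h3 : (-1 : ℤ) ^ (j + i) = (-1) ^ (j + i - 1) * (-1) := by
        rw [← pow_succ]; congr 1; omega
      have h4 : (-1 : ℤ) ^ j * (-1) ^ j = 1 := by
        rw [← mul_pow]; simp
      rw [pow_add] at h3
      linear_combination (-1) ^ j * h3 - (-1) ^ i * h4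
    rw [Nat.add_sub_cancel_left, neg_pow (n : ℤ) i]
    linear_combination ((j + i).choose j : ℤ) * (n.choose j : ℤ) * (n : ℤ) ^ i * e
  have hsum : ∀ f : ℕ → ℤ, ∑ l ∈ Finset.range (k + 1), f l =
      f 0 + f 1 + ∑ l ∈ Finset.Icc 2 k, f l := by
    intro f
    rw [Finset.range_eq_Ico, Finset.sum_eq_sum_Ico_succ_bot (by omega),
      Finset.sum_eq_sum_Ico_succ_bot (by omega), ← add_assoc]
    rfl
  rw [hsum] at h
  rw [Finset.sum_congr rfl fun l hl => by rw [hT l hl]]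
  simp only [mul_neg, Finset.sum_neg_distrib]
  simp [Finset.sum_range_succ] at h
  simp [Finset.sum_range_succ]
  linarith
end

section
/- Let F = (F_0, F_1, F_2, F_3) with F_0 = X_0(X_1X_2 − X_0X_3), F_1 = X_1(X_1X_2 − X_0X_3), F_2 = X_0X_1(X_2 − X_3), F_3 = X_0X_1(X_0 − X_1), and let G = (G_0, G_1, G_2, G_3) with G_0 = X_0X_3, G_1 = X_1X_3, G_2 = X_0(X_2 − X_1), G_3 = X_1(X_2 − X_0), all in ℤ[X_0, X_1, X_2, X_3]. Then there exists a nonzero polynomial q ∈ ℤ[X_0, X_1, X_2, X_3] such that F_i(G_0, G_1, G_2, G_3) = q · X_i for all i = 0, 1, 2, 3, and there exists a nonzero polynomial q' such that G_i(F_0, F_1, F_2, F_3) = q' · X_i for all i. (The Cremona transformation F of ℙ^3 of Example 3 has inverse G.) -/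
open MvPolynomial

/-- The components of the Cremona transformation `F` of Example 3. -/
noncomputable def exampleF : Fin 4 → MvPolynomial (Fin 4) ℤ :=
  ![X 0 * (X 1 * X 2 - X 0 * X 3),
    X 1 * (X 1 * X 2 - X 0 * X 3),
    X 0 * X 1 * (X 2 - X 3),
    X 0 * X 1 * (X 0 - X 1)]

/-- The components of the inverse Cremona transformation `G = F⁻¹` of Example 3. -/
noncomputable def exampleG : Fin 4 → MvPolynomial (Fin 4) ℤ :=
  ![X 0 * X 3,
    X 1 * X 3,
    X 0 * (X 2 - X 1),
    X 1 * (X 2 - X 0)]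

/-- The Cremona transformation `F` of Example 3 has inverse `G`: substituting `G`
into `F` (resp. `F` into `G`) yields the coordinates multiplied by a common nonzero
polynomial. -/
theorem exampleF_inverse_exampleG :
    (∃ q : MvPolynomial (Fin 4) ℤ, q ≠ 0 ∧
        ∀ i : Fin 4, MvPolynomial.bind₁ exampleG (exampleF i) = q * X i) ∧
    (∃ q' : MvPolynomial (Fin 4) ℤ, q' ≠ 0 ∧
        ∀ i : Fin 4, MvPolynomial.bind₁ exampleF (exampleG i) = q' * X i) := by
  refine ⟨⟨X 0 * X 1 * X 3 ^ 2 * (X 0 - X 1), ?_, ?_⟩,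
    ⟨X 0 * X 1 * (X 0 - X 1) * (X 1 * X 2 - X 0 * X 3), ?_, ?_⟩⟩
  · intro h
    have := congrArg (MvPolynomial.eval (![2, 1, 1, 1] : Fin 4 → ℤ)) h
    simp at this
  · intro i
    fin_cases i <;> simp [exampleF, exampleG] <;> ring
  · intro h
    have := congrArg (MvPolynomial.eval (![2, 1, 1, 1] : Fin 4 → ℤ)) h
    simp at this
  · intro i
    fin_cases i <;> simp [exampleF, exampleG] <;> ring
end
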